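/- arXiv:2312.15417 — 5 statements merged into one kernel-verified Lean document; each statement's English description precedes it below -/
import Mathlib

section
/- Let A and B be standard rank-one ℂ[U]-modules. Then ord_U(A ⊗̃ B) = max(ord_U(A), ord_U(B)). -/
open Polynomial TensorProduct

noncomputable section

/-- The action of `U` (i.e. multiplication by `X`) on a `ℂ[U]`-module,
as a `ℂ[U]`-linear endomorphism. -/
def Uact (M : Type) [AddCommGroup M] [Module (Polynomial ℂ) M] :
    M →ₗ[Polynomial ℂ] M :=
  LinearMap.lsmul (Polynomial ℂ) M Polynomial.X

section Tensor

variable (A B : Type)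
  [AddCommGroup A] [Module ℂ A] [Module (Polynomial ℂ) A] [IsScalarTower ℂ (Polynomial ℂ) A]
  [AddCommGroup B] [Module ℂ B] [Module (Polynomial ℂ) B] [IsScalarTower ℂ (Polynomial ℂ) B]

/-- `U₁ = (U•) ⊗ id` on `A ⊗[ℂ] B`, where `ℂ[U]` acts on `A ⊗[ℂ] B` through
the left factor. -/
def U₁ : A ⊗[ℂ] B →ₗ[Polynomial ℂ] A ⊗[ℂ] B :=
  TensorProduct.AlgebraTensorModule.map (Uact A) (LinearMap.id : B →ₗ[ℂ] B)

/-- `U₂ = id ⊗ (U•)` on `A ⊗[ℂ] B`. -/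
def U₂ : A ⊗[ℂ] B →ₗ[Polynomial ℂ] A ⊗[ℂ] B :=
  TensorProduct.AlgebraTensorModule.map (LinearMap.id : A →ₗ[Polynomial ℂ] A)
    ((Uact B).restrictScalars ℂ)

/-- `U₁ - U₂` as a `ℂ[U]`-linear endomorphism of `A ⊗[ℂ] B`. -/
def Udiff : A ⊗[ℂ] B →ₗ[Polynomial ℂ] A ⊗[ℂ] B := U₁ A B - U₂ A B

/-- `coker (U₁ - U₂)` as a `ℂ[U]`-module. -/
abbrev CokerUdiff := (A ⊗[ℂ] B) ⧸ LinearMap.range (Udiff A B)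

/-- `A ⊗̃ B = ker (U₁ - U₂) ⊕ coker (U₁ - U₂)` as a `ℂ[U]`-module. -/
abbrev TildeTensor := LinearMap.ker (Udiff A B) × CokerUdiff A B

end Tensor

/-- `ordSet M = {k | ∃ x ∈ M, U^k • x ≠ 0 ∧ U^(k+1) • x = 0}`. -/
def ordSet (M : Type) [AddCommGroup M] [Module (Polynomial ℂ) M] : Set ℕ :=
  {k | ∃ x : M, (Polynomial.X : Polynomial ℂ) ^ k • x ≠ 0 ∧
    (Polynomial.X : Polynomial ℂ) ^ (k + 1) • x = 0}

/-- The torsion order `ord_U M = sSup (ordSet M)` (in `ℕ`, with `sSup ∅ = 0`). -/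
def ordU (M : Type) [AddCommGroup M] [Module (Polynomial ℂ) M] : ℕ := sSup (ordSet M)

/-- A `ℂ[U]`-module is standard rank-one if it is finitely generated, its torsion
submodule is annihilated by a power of `U`, and the quotient by the torsion
submodule is isomorphic to `ℂ[U]`. -/
def StandardRankOne (M : Type) [AddCommGroup M] [Module (Polynomial ℂ) M] : Prop :=
  Module.Finite (Polynomial ℂ) M ∧
  (∃ n : ℕ, ∀ x ∈ Submodule.torsion (Polynomial ℂ) M, (Polynomial.X : Polynomial ℂ) ^ n • x = 0) ∧
  Nonempty ((M ⧸ Submodule.torsion (Polynomial ℂ) M) ≃ₗ[Polynomial ℂ] Polynomial ℂ)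

section TorsionOrder

variable {M : Type} [AddCommGroup M] [Module (Polynomial ℂ) M]

theorem mem_torsion_of_X_pow_smul_eq_zero {k : ℕ} {x : M}
    (hx : (X : Polynomial ℂ) ^ k • x = 0) : x ∈ Submodule.torsion (Polynomial ℂ) M :=
  (Submodule.mem_torsion_iff x).2
    ⟨⟨X ^ k, mem_nonZeroDivisors_of_ne_zero (pow_ne_zero k X_ne_zero)⟩, hx⟩

theorem X_pow_smul_eq_zero_of_le {j k : ℕ} (hjk : j ≤ k) {x : M}
    (hx : (X : Polynomial ℂ) ^ j • x = 0) : (X : Polynomial ℂ) ^ k • x = 0 := by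
  rw [← Nat.sub_add_cancel hjk, pow_add, mul_smul, hx, smul_zero]

theorem lt_of_mem_ordSet {n k : ℕ} (hk : k ∈ ordSet M)
    (hn : ∀ x : M, (X : Polynomial ℂ) ^ (k + 1) • x = 0 → (X : Polynomial ℂ) ^ n • x = 0) :
    k < n := by
  obtain ⟨x, hx, hx'⟩ := hk
  by_contra! h
  exact hx (X_pow_smul_eq_zero_of_le h (hn x hx'))

theorem StandardRankOne.bddAbove_ordSet (hM : StandardRankOne M) : BddAbove (ordSet M) := by
  obtain ⟨-, ⟨n, hn⟩, -⟩ := hM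
  exact ⟨n, fun k hk => (lt_of_mem_ordSet hk fun x hx =>
    hn x (mem_torsion_of_X_pow_smul_eq_zero hx)).le⟩

theorem StandardRankOne.X_pow_smul_torsion (hM : StandardRankOne M) {x : M}
    (hx : x ∈ Submodule.torsion (Polynomial ℂ) M) :
    (X : Polynomial ℂ) ^ (ordU M + 1) • x = 0 := by
  classical
  obtain ⟨n, hn⟩ := hM.2.1
  have h : ∃ j, (X : Polynomial ℂ) ^ j • x = 0 := ⟨n, hn x hx⟩
  refine X_pow_smul_eq_zero_of_le ?_ (Nat.find_spec h)
  rcases hj : Nat.find h with _ | j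
  · exact Nat.zero_le _
  · have hmem : j ∈ ordSet M :=
      ⟨x, Nat.find_min h (by omega), hj ▸ Nat.find_spec h⟩
    exact Nat.succ_le_succ (le_csSup hM.bddAbove_ordSet hmem)

/-- A standard rank-one module splits off a free summand of rank one, up to torsion. -/
theorem StandardRankOne.exists_functional (hM : StandardRankOne M) :
    ∃ (φ : M →ₗ[Polynomial ℂ] Polynomial ℂ) (e : M), φ e = 1 ∧
      ∀ x, (X : Polynomial ℂ) ^ (ordU M + 1) • x =
        (X : Polynomial ℂ) ^ (ordU M + 1) • φ x • e := by
  obtain ⟨f⟩ := hM.2.2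
  obtain ⟨e, he⟩ := Submodule.mkQ_surjective _ (f.symm 1)
  have hφe : (f.toLinearMap ∘ₗ Submodule.mkQ _) e = 1 := by simp [he]
  refine ⟨f.toLinearMap ∘ₗ Submodule.mkQ _, e, hφe, fun x => ?_⟩
  rw [← sub_eq_zero, ← smul_sub]
  apply hM.X_pow_smul_torsion
  refine (Submodule.Quotient.mk_eq_zero _).1 (f.injective ?_)
  change (f.toLinearMap ∘ₗ Submodule.mkQ _) _ = _
  rw [map_sub, map_smul, hφe]
  simp

end TorsionOrder

theorem LinearMap.exists_comp_eq_of_ker_le {K V W W' : Type*} [Field K]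
    [AddCommGroup V] [Module K V] [AddCommGroup W] [Module K W] [AddCommGroup W'] [Module K W']
    {f : V →ₗ[K] W} {g : V →ₗ[K] W'} (h : LinearMap.ker f ≤ LinearMap.ker g) :
    ∃ r : W →ₗ[K] W', r ∘ₗ f = g := by
  obtain ⟨r, hr⟩ := LinearMap.exists_extend
    ((LinearMap.ker f).liftQ g h ∘ₗ f.quotKerEquivRange.symm.toLinearMap)
  refine ⟨r, LinearMap.ext fun v => ?_⟩
  have := LinearMap.congr_fun hr (f.quotKerEquivRange (Submodule.Quotient.mk v))
  simpa using this

theorem X_pow_smul_tensor_eq_zero {A B : Type}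
    [AddCommGroup A] [Module ℂ A] [Module (Polynomial ℂ) A] [IsScalarTower ℂ (Polynomial ℂ) A]
    [AddCommGroup B] [Module ℂ B] {k n : ℕ}
    (h : ∀ a : A, (X : Polynomial ℂ) ^ k • a = 0 → (X : Polynomial ℂ) ^ n • a = 0)
    {z : A ⊗[ℂ] B} (hz : (X : Polynomial ℂ) ^ k • z = 0) : (X : Polynomial ℂ) ^ n • z = 0 := by
  let f (k : ℕ) : A →ₗ[ℂ] A := (LinearMap.lsmul (Polynomial ℂ) A (X ^ k)).restrictScalars ℂ
  have hf (k : ℕ) (z : A ⊗[ℂ] B) : (X : Polynomial ℂ) ^ k • z = (f k).rTensor B z := by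
    induction z with
    | zero => simp
    | add x y hx hy => rw [smul_add, hx, hy, map_add]
    | tmul a b => rfl
  obtain ⟨r, hr⟩ := LinearMap.exists_comp_eq_of_ker_le (f := f k) (g := f n) h
  rw [hf] at hz ⊢
  rw [← hr, LinearMap.rTensor_comp_apply, hz, map_zero]

section Coker

variable {A B : Type}
  [AddCommGroup A] [Module ℂ A] [Module (Polynomial ℂ) A] [IsScalarTower ℂ (Polynomial ℂ) A]
  [AddCommGroup B] [Module ℂ B] [Module (Polynomial ℂ) B] [IsScalarTower ℂ (Polynomial ℂ) B]

theorem Udiff_tmul (a : A) (b : B) :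
    Udiff A B (a ⊗ₜ b) = ((X : Polynomial ℂ) • a) ⊗ₜ b - a ⊗ₜ ((X : Polynomial ℂ) • b) :=
  rfl

/-- The class of a pure tensor in the cokernel of `U₁ - U₂`. -/
def cokerMk (a : A) (b : B) : CokerUdiff A B :=
  Submodule.Quotient.mk (a ⊗ₜ b)

theorem smul_cokerMk (p : Polynomial ℂ) (a : A) (b : B) :
    p • cokerMk a b = cokerMk (p • a) b :=
  rfl

theorem X_smul_cokerMk (a : A) (b : B) :
    (X : Polynomial ℂ) • cokerMk a b = cokerMk a ((X : Polynomial ℂ) • b) :=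
  (Submodule.Quotient.eq _).2 ⟨a ⊗ₜ b, Udiff_tmul a b⟩

theorem cokerMk_smul (p : Polynomial ℂ) (a : A) (b : B) :
    cokerMk a (p • b) = p • cokerMk a b := by
  induction p using Polynomial.induction_on' generalizing b with
  | add p q hp hq =>
    rw [add_smul, add_smul, ← hp, ← hq]
    simp only [cokerMk, TensorProduct.tmul_add, Submodule.Quotient.mk_add]
  | monomial n c =>
    induction n generalizing b with
    | zero =>
      rw [monomial_zero_left, smul_cokerMk, C_eq_algebraMap, algebraMap_smul, algebraMap_smul,
        cokerMk, cokerMk, TensorProduct.smul_tmul]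
    | succ n ih =>
      rw [← monomial_mul_X, mul_smul, ih, ← X_smul_cokerMk, mul_smul]

/-- The natural map from the cokernel of `U₁ - U₂` to the tensor product over `ℂ[U]`. -/
def cokerToTensor : CokerUdiff A B →ₗ[Polynomial ℂ] A ⊗[Polynomial ℂ] B :=
  (LinearMap.range (Udiff A B)).liftQ
    (TensorProduct.mapOfCompatibleSMul (Polynomial ℂ) ℂ (Polynomial ℂ) A B) <| by
      rintro _ ⟨z, rfl⟩
      rw [LinearMap.mem_ker]
      induction z with
      | zero => simp
      | add x y hx hy => rw [map_add, map_add, hx, hy, add_zero]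
      | tmul a b => simp [Udiff_tmul, TensorProduct.smul_tmul']

theorem cokerToTensor_cokerMk (a : A) (b : B) :
    cokerToTensor (cokerMk a b) = a ⊗ₜ[Polynomial ℂ] b :=
  rfl

theorem ordSet_left_subset {φ : B →ₗ[Polynomial ℂ] Polynomial ℂ} {e : B} (he : φ e = 1) :
    ordSet A ⊆ ordSet (TildeTensor A B) := by
  rintro k ⟨a, ha, ha'⟩
  refine ⟨(0, cokerMk a e), fun h => ha ?_, ?_⟩
  · have h2 := congrArg (fun z => TensorProduct.rid _ _ (φ.lTensor A (cokerToTensor z.2))) h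
    simpa [smul_cokerMk, cokerToTensor_cokerMk, he] using h2
  · ext
    · simp
    · simp only [Prod.smul_snd, Prod.snd_zero, smul_cokerMk, ha']
      simp [cokerMk]

theorem ordSet_right_subset {φ : A →ₗ[Polynomial ℂ] Polynomial ℂ} {e : A} (he : φ e = 1) :
    ordSet B ⊆ ordSet (TildeTensor A B) := by
  rintro k ⟨b, hb, hb'⟩
  refine ⟨(0, cokerMk e b), fun h => hb ?_, ?_⟩
  · have h2 := congrArg (fun z => TensorProduct.lid _ _ (φ.rTensor B (cokerToTensor z.2))) h
    simpa [← cokerMk_smul, cokerToTensor_cokerMk, he] using h2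
  · ext
    · simp
    · simp only [Prod.smul_snd, Prod.snd_zero, ← cokerMk_smul, hb']
      simp [cokerMk]

theorem X_pow_smul_coker_eq_zero {n k : ℕ}
    {φ : A →ₗ[Polynomial ℂ] Polynomial ℂ} {a₀ : A}
    (hφ : ∀ a, (X : Polynomial ℂ) ^ n • a = (X : Polynomial ℂ) ^ n • φ a • a₀)
    {χ : B →ₗ[Polynomial ℂ] Polynomial ℂ} {b₀ : B}
    (hχ : ∀ b, (X : Polynomial ℂ) ^ n • b = (X : Polynomial ℂ) ^ n • χ b • b₀)
    {z : CokerUdiff A B} (hz : (X : Polynomial ℂ) ^ k • z = 0) :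
    (X : Polynomial ℂ) ^ n • z = 0 := by
  let ψ : CokerUdiff A B →ₗ[Polynomial ℂ] Polynomial ℂ :=
    (TensorProduct.lid _ _).toLinearMap ∘ₗ TensorProduct.map φ χ ∘ₗ cokerToTensor
  have key (z : CokerUdiff A B) :
      (X : Polynomial ℂ) ^ n • z = (X : Polynomial ℂ) ^ n • ψ z • cokerMk a₀ b₀ := by
    obtain ⟨t, rfl⟩ := Submodule.Quotient.mk_surjective _ z
    induction t with
    | zero => simp
    | add x y hx hy => simp only [Submodule.Quotient.mk_add, smul_add, hx, hy, map_add, add_smul]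
    | tmul a b =>
      change _ • cokerMk a b = _ • ψ (cokerMk a b) • _
      have hψ : ψ (cokerMk a b) = φ a * χ b := by simp [ψ, cokerToTensor_cokerMk]
      rw [hψ, smul_cokerMk, hφ, ← smul_cokerMk, ← smul_cokerMk, smul_comm, ← cokerMk_smul, hχ,
        cokerMk_smul, cokerMk_smul, smul_comm, mul_smul]
  have h0 : (X : Polynomial ℂ) ^ k * ψ z = 0 := by
    rw [← smul_eq_mul, ← map_smul, hz, map_zero]
  rw [key, (mul_eq_zero.1 h0).resolve_left (pow_ne_zero k X_ne_zero), zero_smul, smul_zero]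

end Coker

variable (A B : Type)
  [AddCommGroup A] [Module ℂ A] [Module (Polynomial ℂ) A] [IsScalarTower ℂ (Polynomial ℂ) A]
  [AddCommGroup B] [Module ℂ B] [Module (Polynomial ℂ) B] [IsScalarTower ℂ (Polynomial ℂ) B]

/-- For standard rank-one `ℂ[U]`-modules `A` and `B`,
`ord_U (A ⊗̃ B) = max (ord_U A) (ord_U B)`. -/
theorem ordU_tildeTensor (hA : StandardRankOne A) (hB : StandardRankOne B) :
    ordU (TildeTensor A B) = max (ordU A) (ordU B) := by
  obtain ⟨φ, a₀, hφ, hA'⟩ := hA.exists_functional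
  obtain ⟨χ, b₀, hχ, hB'⟩ := hB.exists_functional
  have lift {M : Type} [AddCommGroup M] [Module (Polynomial ℂ) M] {m n : ℕ} (hmn : m ≤ n)
      {x y : M} (h : (X : Polynomial ℂ) ^ m • x = (X : Polynomial ℂ) ^ m • y) :
      (X : Polynomial ℂ) ^ n • x = (X : Polynomial ℂ) ^ n • y := by
    rw [← sub_eq_zero, ← smul_sub] at h ⊢
    exact X_pow_smul_eq_zero_of_le hmn h
  have hle (k : ℕ) (hk : k ∈ ordSet (TildeTensor A B)) : k ≤ max (ordU A) (ordU B) := by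
    refine Nat.lt_succ_iff.1 (lt_of_mem_ordSet hk fun x hx => Prod.ext (Subtype.ext ?_) ?_)
    · refine X_pow_smul_tensor_eq_zero (k := k + 1) (fun a ha => ?_)
        (congrArg Subtype.val (congrArg Prod.fst hx))
      exact X_pow_smul_eq_zero_of_le (Nat.succ_le_succ (le_max_left _ _))
        (hA.X_pow_smul_torsion (mem_torsion_of_X_pow_smul_eq_zero ha))
    · exact X_pow_smul_coker_eq_zero
        (fun a => lift (Nat.succ_le_succ (le_max_left _ _)) (hA' a))
        (fun b => lift (Nat.succ_le_succ (le_max_right _ _)) (hB' b))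
        (congrArg Prod.snd hx)
  have hsub : ordSet A ∪ ordSet B ⊆ ordSet (TildeTensor A B) :=
    Set.union_subset (ordSet_left_subset hχ) (ordSet_right_subset hφ)
  have mono {S T : Set ℕ} (hT : BddAbove T) (h : S ⊆ T) : sSup S ≤ sSup T := by
    rcases S.eq_empty_or_nonempty with rfl | hS
    · simp
    · exact csSup_le_csSup hT hS h
  have hbdd : BddAbove (ordSet (TildeTensor A B)) := ⟨_, hle⟩
  refine le_antisymm ?_ (max_le (mono hbdd (Set.subset_union_left.trans hsub))
    (mono hbdd (Set.subset_union_right.trans hsub)))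
  rcases (ordSet (TildeTensor A B)).eq_empty_or_nonempty with h | h
  · simp [ordU, h]
  · exact csSup_le h hle

end
end

section
/- Let A and B be ℂ[U]-modules, let r ∈ ℕ, and let a' ∈ A satisfy U^r • a' ≠ 0 and U^{r+1} • a' = 0. Suppose b ∈ B is an element with trivial annihilator such that B is the internal direct sum of the cyclic submodule ℂ[U] • b and some ℂ[U]-submodule C. Then U₁^r (a' ⊗ b) does not lie in the range of U₁ − U₂; consequently the class of a' ⊗ b in coker(U₁ − U₂) is a nonzero U-torsion element with U^r • [a' ⊗ b] ≠ 0 and U^{r+1} • [a' ⊗ b] = 0. -/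
open Polynomial TensorProduct

noncomputable section

/-- A generator with trivial annihilator of a cyclic direct summand is sent to `1` by some
linear functional. -/
theorem exists_linearMap_apply_eq_one_of_isCompl_span_singleton {R M : Type*} [CommRing R]
    [AddCommGroup M] [Module R M] {b : M} (hb : ∀ p : R, p • b = 0 → p = 0)
    {C : Submodule R M} (hC : IsCompl (Submodule.span R {b}) C) :
    ∃ φ : M →ₗ[R] R, φ b = 1 := by
  have hinj : Function.Injective (LinearMap.toSpanSingleton R M b) :=
    (injective_iff_map_eq_zero _).2 fun p hp => hb p (by simpa using hp)
  rw [← LinearMap.range_toSpanSingleton] at hC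
  let e := LinearEquiv.ofInjective (LinearMap.toSpanSingleton R M b) hinj
  refine ⟨e.symm.toLinearMap ∘ₗ Submodule.projectionOnto _ C hC, ?_⟩
  have he : ((e 1 : LinearMap.range (LinearMap.toSpanSingleton R M b)) : M) = b := by
    simp [e]
  have hp := Submodule.projectionOnto_apply_left hC (e 1)
  rw [he] at hp
  simp [hp]

/-- The `ℂ`-linear map `A ⊗[ℂ] B → A`, `a ⊗ b ↦ φ b • a`, induced by a functional `φ`. -/
def smulContraction {A B : Type}
    [AddCommGroup A] [Module ℂ A] [Module (Polynomial ℂ) A] [IsScalarTower ℂ (Polynomial ℂ) A]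
    [AddCommGroup B] [Module ℂ B] [Module (Polynomial ℂ) B] [IsScalarTower ℂ (Polynomial ℂ) B]
    (φ : B →ₗ[Polynomial ℂ] Polynomial ℂ) : A ⊗[ℂ] B →ₗ[ℂ] A :=
  TensorProduct.lift ((Algebra.lsmul ℂ ℂ A).toLinearMap ∘ₗ φ.restrictScalars ℂ).flip

theorem smulContraction_tmul {A B : Type}
    [AddCommGroup A] [Module ℂ A] [Module (Polynomial ℂ) A] [IsScalarTower ℂ (Polynomial ℂ) A]
    [AddCommGroup B] [Module ℂ B] [Module (Polynomial ℂ) B] [IsScalarTower ℂ (Polynomial ℂ) B]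
    (φ : B →ₗ[Polynomial ℂ] Polynomial ℂ) (a : A) (b : B) :
    smulContraction φ (a ⊗ₜ[ℂ] b) = φ b • a := rfl

theorem smulContraction_Udiff {A B : Type}
    [AddCommGroup A] [Module ℂ A] [Module (Polynomial ℂ) A] [IsScalarTower ℂ (Polynomial ℂ) A]
    [AddCommGroup B] [Module ℂ B] [Module (Polynomial ℂ) B] [IsScalarTower ℂ (Polynomial ℂ) B]
    (φ : B →ₗ[Polynomial ℂ] Polynomial ℂ) (t : A ⊗[ℂ] B) :
    smulContraction φ (Udiff A B t) = 0 := by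
  induction t with
  | zero => simp
  | add x y hx hy => rw [map_add, map_add, hx, hy, add_zero]
  | tmul a b =>
    simp [Udiff, U₁, U₂, Uact, smulContraction_tmul, smul_smul, mul_comm]

theorem U₁_pow_apply {A B : Type}
    [AddCommGroup A] [Module ℂ A] [Module (Polynomial ℂ) A] [IsScalarTower ℂ (Polynomial ℂ) A]
    [AddCommGroup B] [Module ℂ B] [Module (Polynomial ℂ) B] [IsScalarTower ℂ (Polynomial ℂ) B]
    (n : ℕ) (a : A) (b : B) :
    ((U₁ A B) ^ n) (a ⊗ₜ[ℂ] b) = ((Polynomial.X : Polynomial ℂ) ^ n • a) ⊗ₜ[ℂ] b := by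
  induction n with
  | zero => simp
  | succ n ih =>
    rw [pow_succ', Module.End.mul_apply, ih]
    simp [U₁, Uact, smul_smul, pow_succ]

variable (A B : Type)
  [AddCommGroup A] [Module ℂ A] [Module (Polynomial ℂ) A] [IsScalarTower ℂ (Polynomial ℂ) A]
  [AddCommGroup B] [Module ℂ B] [Module (Polynomial ℂ) B] [IsScalarTower ℂ (Polynomial ℂ) B]

/-- If `a' ∈ A` satisfies `U^r • a' ≠ 0` and `U^(r+1) • a' = 0`, and `b ∈ B` has trivial
annihilator and generates a direct summand `ℂ[U] • b` of `B`, then `U₁^r (a' ⊗ b)` is not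
in the range of `U₁ - U₂`; consequently the class of `a' ⊗ b` in `coker (U₁ - U₂)` is a
nonzero `U`-torsion element with `U^r • [a' ⊗ b] ≠ 0` and `U^(r+1) • [a' ⊗ b] = 0`. -/
theorem class_of_tmul_is_torsion_of_order_r (r : ℕ) (a' : A) (b : B)
    (ha1 : (Polynomial.X : Polynomial ℂ) ^ r • a' ≠ 0)
    (ha2 : (Polynomial.X : Polynomial ℂ) ^ (r + 1) • a' = 0)
    (hb : ∀ p : Polynomial ℂ, p • b = 0 → p = 0)
    (hsplit : ∃ C : Submodule (Polynomial ℂ) B,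
      IsCompl (Submodule.span (Polynomial ℂ) ({b} : Set B)) C) :
    ((U₁ A B) ^ r) (a' ⊗ₜ[ℂ] b) ∉ LinearMap.range (Udiff A B) ∧
    (Submodule.Quotient.mk (a' ⊗ₜ[ℂ] b) : CokerUdiff A B) ≠ 0 ∧
    (Polynomial.X : Polynomial ℂ) ^ r •
      (Submodule.Quotient.mk (a' ⊗ₜ[ℂ] b) : CokerUdiff A B) ≠ 0 ∧
    (Polynomial.X : Polynomial ℂ) ^ (r + 1) •
      (Submodule.Quotient.mk (a' ⊗ₜ[ℂ] b) : CokerUdiff A B) = 0 := by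
  obtain ⟨C, hC⟩ := hsplit
  obtain ⟨φ, hφ⟩ := exists_linearMap_apply_eq_one_of_isCompl_span_singleton hb hC
  have hrange : ((U₁ A B) ^ r) (a' ⊗ₜ[ℂ] b) ∉ LinearMap.range (Udiff A B) := by
    rintro ⟨t, ht⟩
    apply ha1
    have h := smulContraction_Udiff φ t
    rwa [ht, U₁_pow_apply, smulContraction_tmul, hφ, one_smul] at h
  have hne : (Polynomial.X : Polynomial ℂ) ^ r •
      (Submodule.Quotient.mk (a' ⊗ₜ[ℂ] b) : CokerUdiff A B) ≠ 0 := by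
    rwa [← Submodule.Quotient.mk_smul, Ne, Submodule.Quotient.mk_eq_zero,
      TensorProduct.smul_tmul', ← U₁_pow_apply]
  refine ⟨hrange, fun h => hne (by rw [h, smul_zero]), hne, ?_⟩
  rw [← Submodule.Quotient.mk_smul, TensorProduct.smul_tmul', ha2, TensorProduct.zero_tmul,
    Submodule.Quotient.mk_zero]

end
end

section
/- Let A and B be finitely generated ℂ[U]-modules and let m ∈ ℕ be such that U^m annihilates the torsion submodule T(B). Then every x ∈ A ⊗_ℂ B with U₁ x = U₂ x satisfies U₁^m x = 0. -/
open Polynomial TensorProduct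

noncomputable section

/-- The slice map `a ⊗ b ↦ (φ ↦ φ a • b)`. -/
def tensorSlice (A B : Type) [AddCommGroup A] [Module ℂ A] [AddCommGroup B] [Module ℂ B] :
    A ⊗[ℂ] B →ₗ[ℂ] Module.Dual ℂ A →ₗ[ℂ] B :=
  TensorProduct.lift (LinearMap.mk₂ ℂ
    (fun a b => (LinearMap.toSpanSingleton ℂ B b).comp (Module.Dual.eval ℂ A a))
    (fun a a' b => by ext φ; simp [add_smul])
    (fun c a b => by ext φ; simp [mul_smul])
    (fun a b b' => by ext φ; simp)
    (fun c a b => by ext φ; simp [smul_comm c]))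

@[simp]
theorem tensorSlice_tmul {A B : Type} [AddCommGroup A] [Module ℂ A] [AddCommGroup B]
    [Module ℂ B] (a : A) (b : B) (φ : Module.Dual ℂ A) :
    tensorSlice A B (a ⊗ₜ b) φ = φ a • b := rfl

theorem tensorSlice_injective (A B : Type) [AddCommGroup A] [Module ℂ A] [AddCommGroup B]
    [Module ℂ B] : Function.Injective (tensorSlice A B) := by
  classical
  rw [injective_iff_map_eq_zero]
  intro x hx
  let v := Module.Basis.ofVectorSpace ℂ A
  apply (TensorProduct.equivFinsuppOfBasisLeft (N := B) v).injective
  have h : ∀ (y : A ⊗[ℂ] B) i,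
      TensorProduct.equivFinsuppOfBasisLeft v y i = tensorSlice A B y (v.coord i) := by
    intro y i
    induction y with
    | zero => simp
    | tmul a b => simp
    | add y z hy hz => simp [hy, hz]
  ext i
  simp [h, hx]

theorem finiteDimensional_range_tensorSlice {A B : Type} [AddCommGroup A] [Module ℂ A]
    [AddCommGroup B] [Module ℂ B] (x : A ⊗[ℂ] B) :
    FiniteDimensional ℂ (LinearMap.range (tensorSlice A B x)) := by
  induction x with
  | zero => rw [map_zero, LinearMap.range_zero]; infer_instance
  | tmul a b =>
    refine Submodule.finiteDimensional_of_le (S₂ := ℂ ∙ b) ?_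
    rintro _ ⟨φ, rfl⟩
    exact Submodule.smul_mem _ _ (Submodule.mem_span_singleton_self b)
  | add y z hy hz =>
    refine Submodule.finiteDimensional_of_le
      (S₂ := LinearMap.range (tensorSlice A B y) ⊔ LinearMap.range (tensorSlice A B z)) ?_
    rintro _ ⟨φ, rfl⟩
    rw [map_add]
    exact Submodule.add_mem_sup ⟨φ, rfl⟩ ⟨φ, rfl⟩

/-- A finite-dimensional subspace stable under `X` consists of torsion elements. -/
theorem mem_torsion_of_finiteDimensional {B : Type} [AddCommGroup B] [Module ℂ B]
    [Module ℂ[X] B] [IsScalarTower ℂ ℂ[X] B] (W : Submodule ℂ B) [FiniteDimensional ℂ W]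
    (hW : ∀ w ∈ W, (X : ℂ[X]) • w ∈ W) {w : B} (hw : w ∈ W) :
    w ∈ Submodule.torsion ℂ[X] B := by
  have hmem : ∀ p : ℂ[X], p • w ∈ W := by
    intro p
    induction p using Polynomial.induction_on' with
    | add p q hp hq => rw [add_smul]; exact W.add_mem hp hq
    | monomial n c =>
      rw [← Polynomial.smul_X_eq_monomial, smul_assoc]
      refine W.smul_mem c ?_
      induction n with
      | zero => simpa using hw
      | succ n ih => rw [pow_succ', mul_smul]; exact hW _ ih
  let f : ℂ[X] →ₗ[ℂ] W :=
    ((LinearMap.toSpanSingleton ℂ[X] B w).restrictScalars ℂ).codRestrict W hmem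
  have hf : ¬ Function.Injective f := fun h =>
    Polynomial.not_finite (R := ℂ) (Module.Finite.of_injective f h)
  rw [injective_iff_map_eq_zero] at hf
  push Not at hf
  obtain ⟨p, hp, hp0⟩ := hf
  rw [Submodule.mem_torsion_iff]
  exact ⟨⟨p, mem_nonZeroDivisors_of_ne_zero hp0⟩, congrArg Subtype.val hp⟩

theorem tensorSlice_U₁ {A B : Type} [AddCommGroup A] [Module ℂ A] [Module ℂ[X] A]
    [IsScalarTower ℂ ℂ[X] A] [AddCommGroup B] [Module ℂ B]
    (y : A ⊗[ℂ] B) (φ : Module.Dual ℂ A) :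
    tensorSlice A B (U₁ A B y) φ =
      tensorSlice A B y (φ.comp ((Uact A).restrictScalars ℂ)) := by
  induction y with
  | zero => simp
  | tmul a b => rfl
  | add y z hy hz => simp only [map_add, LinearMap.add_apply, hy, hz]

theorem tensorSlice_U₂ {A B : Type} [AddCommGroup A] [Module ℂ A] [Module ℂ[X] A]
    [IsScalarTower ℂ ℂ[X] A] [AddCommGroup B] [Module ℂ B] [Module ℂ[X] B]
    [IsScalarTower ℂ ℂ[X] B]
    (y : A ⊗[ℂ] B) (φ : Module.Dual ℂ A) :
    tensorSlice A B (U₂ A B y) φ = (X : ℂ[X]) • tensorSlice A B y φ := by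
  induction y with
  | zero => simp
  | tmul a b => exact smul_comm (φ a) (X : ℂ[X]) b
  | add y z hy hz => simp only [map_add, LinearMap.add_apply, hy, hz, smul_add]

theorem tensorSlice_U₁_pow {A B : Type} [AddCommGroup A] [Module ℂ A] [Module ℂ[X] A]
    [IsScalarTower ℂ ℂ[X] A] [AddCommGroup B] [Module ℂ B] [Module ℂ[X] B]
    [IsScalarTower ℂ ℂ[X] B]
    {x : A ⊗[ℂ] B} (hx : U₁ A B x = U₂ A B x) (k : ℕ)
    (φ : Module.Dual ℂ A) :
    tensorSlice A B (((U₁ A B) ^ k) x) φ = (X : ℂ[X]) ^ k • tensorSlice A B x φ := by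
  induction k generalizing φ with
  | zero => simp
  | succ k ih =>
    rw [pow_succ', Module.End.mul_apply, tensorSlice_U₁, ih, ← tensorSlice_U₁, hx,
      tensorSlice_U₂, pow_succ, mul_smul]

variable (A B : Type)
  [AddCommGroup A] [Module ℂ A] [Module (Polynomial ℂ) A] [IsScalarTower ℂ (Polynomial ℂ) A]
  [AddCommGroup B] [Module ℂ B] [Module (Polynomial ℂ) B] [IsScalarTower ℂ (Polynomial ℂ) B]

/-- If `A`, `B` are finitely generated and `U^m` annihilates the torsion submodule of `B`,
then every `x ∈ A ⊗[ℂ] B` with `U₁ x = U₂ x` satisfies `U₁^m x = 0`. -/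
theorem ker_Udiff_killed_by_Um
    [Module.Finite (Polynomial ℂ) A] [Module.Finite (Polynomial ℂ) B] (m : ℕ)
    (hm : ∀ x ∈ Submodule.torsion (Polynomial ℂ) B, (Polynomial.X : Polynomial ℂ) ^ m • x = 0)
    (x : A ⊗[ℂ] B) (hx : U₁ A B x = U₂ A B x) :
    ((U₁ A B) ^ m) x = 0 := by
  apply tensorSlice_injective A B
  ext φ
  rw [tensorSlice_U₁_pow hx, map_zero, LinearMap.zero_apply]
  have := finiteDimensional_range_tensorSlice x
  refine hm _ (mem_torsion_of_finiteDimensional (LinearMap.range (tensorSlice A B x)) ?_ ⟨φ, rfl⟩)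
  rintro _ ⟨ψ, rfl⟩
  exact ⟨ψ.comp ((Uact A).restrictScalars ℂ), by rw [← tensorSlice_U₁, hx, tensorSlice_U₂]⟩

end
end

section
/- Let A and B be finitely generated ℂ[U]-modules and let m ∈ ℕ be such that U^m annihilates both torsion submodules T(A) and T(B). Then every U-torsion element of coker(U₁ − U₂ : A ⊗_ℂ B → A ⊗_ℂ B) is annihilated by U^m. -/
open Polynomial TensorProduct

noncomputable section

variable (A B : Type)
  [AddCommGroup A] [Module ℂ A] [Module (Polynomial ℂ) A] [IsScalarTower ℂ (Polynomial ℂ) A]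
  [AddCommGroup B] [Module ℂ B] [Module (Polynomial ℂ) B] [IsScalarTower ℂ (Polynomial ℂ) B]

/-- The relations `p • a ⊗ b = a ⊗ p • b` defining `A ⊗[ℂ[U]] B` as a quotient of `A ⊗[ℂ] B`
all lie in the range of `U₁ - U₂`. -/
lemma smul_tmul_sub_tmul_smul_mem_range_Udiff (p : Polynomial ℂ) (a : A) (b : B) :
    (p • a) ⊗ₜ[ℂ] b - a ⊗ₜ[ℂ] (p • b) ∈ LinearMap.range (Udiff A B) := by
  have hX (a : A) (b : B) : ((X : Polynomial ℂ) • a) ⊗ₜ[ℂ] b - a ⊗ₜ[ℂ] ((X : Polynomial ℂ) • b) ∈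
      LinearMap.range (Udiff A B) := ⟨a ⊗ₜ b, rfl⟩
  induction p using Polynomial.induction_on generalizing a b with
  | C c =>
    have hC (M : Type) [AddCommGroup M] [Module ℂ M] [Module (Polynomial ℂ) M]
        [IsScalarTower ℂ (Polynomial ℂ) M] (x : M) : (C c : Polynomial ℂ) • x = c • x :=
      algebraMap_smul (Polynomial ℂ) c x
    rw [hC, hC, TensorProduct.smul_tmul, sub_self]
    exact zero_mem _
  | add p q hp hq =>
    simp only [add_smul, TensorProduct.add_tmul, TensorProduct.tmul_add, add_sub_add_comm]
    exact add_mem (hp a b) (hq a b)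
  | monomial n c h =>
    have h₁ := h ((X : Polynomial ℂ) • a) b
    have h₂ := hX a ((C c * X ^ n : Polynomial ℂ) • b)
    rw [pow_succ, ← mul_assoc]
    have h₃ := add_mem h₁ h₂
    rw [sub_add_sub_cancel, smul_smul, smul_smul, mul_comm X] at h₃
    exact h₃

lemma ker_mapOfCompatibleSMul_le_range_Udiff :
    LinearMap.ker (TensorProduct.mapOfCompatibleSMul (Polynomial ℂ) ℂ (Polynomial ℂ) A B) ≤
      LinearMap.range (Udiff A B) := by
  rw [TensorProduct.AlgebraTensorModule.ker_mapOfCompatibleSMul, Submodule.span_le]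
  rintro _ ⟨p, a, b, rfl⟩
  exact smul_tmul_sub_tmul_smul_mem_range_Udiff A B p a b

lemma range_Udiff_le_ker_mapOfCompatibleSMul :
    LinearMap.range (Udiff A B) ≤
      LinearMap.ker (TensorProduct.mapOfCompatibleSMul (Polynomial ℂ) ℂ (Polynomial ℂ) A B) := by
  rw [LinearMap.range_le_ker_iff]
  ext a b
  simp [Udiff, U₁, U₂, Uact, TensorProduct.smul_tmul']

/-- Over a principal ideal domain, an element `r` annihilating the torsion of two finitely
generated modules annihilates the torsion of their tensor product. -/
lemma smul_eq_zero_of_mem_torsion_tensorProduct {R M N : Type*} [CommRing R] [IsDomain R]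
    [IsPrincipalIdealRing R] [AddCommGroup M] [Module R M] [Module.Finite R M]
    [AddCommGroup N] [Module R N] [Module.Finite R N] {r : R}
    (hM : ∀ x ∈ Submodule.torsion R M, r • x = 0)
    (hN : ∀ x ∈ Submodule.torsion R N, r • x = 0)
    {z : M ⊗[R] N} {s : R} (hs : s ≠ 0) (hz : s • z = 0) : r • z = 0 := by
  have hker : z ∈ LinearMap.ker (TensorProduct.map (Submodule.torsion R M).mkQ
      (Submodule.torsion R N).mkQ) := by
    rw [LinearMap.mem_ker]
    refine (smul_eq_zero_iff_right hs).mp ?_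
    rw [← map_smul, hz, map_zero]
  rw [TensorProduct.map_ker (LinearMap.exact_subtype_mkQ _) (Submodule.mkQ_surjective _)
    (LinearMap.exact_subtype_mkQ _) (Submodule.mkQ_surjective _)] at hker
  suffices h : _ ≤ LinearMap.ker (LinearMap.lsmul R (M ⊗[R] N) r) from h hker
  refine sup_le ?_ ?_
  · rw [LinearMap.range_le_ker_iff]
    ext m n
    simp [← TensorProduct.tmul_smul, hN n n.2]
  · rw [LinearMap.range_le_ker_iff]
    ext m n
    simp [TensorProduct.smul_tmul', hM m m.2]

/-- If `A`, `B` are finitely generated and `U^m` annihilates both torsion submodules, then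
every `U`-torsion element of `coker (U₁ - U₂)` is annihilated by `U^m`. -/
theorem coker_torsion_killed_by_Um
    [Module.Finite (Polynomial ℂ) A] [Module.Finite (Polynomial ℂ) B] (m : ℕ)
    (hmA : ∀ x ∈ Submodule.torsion (Polynomial ℂ) A, (Polynomial.X : Polynomial ℂ) ^ m • x = 0)
    (hmB : ∀ x ∈ Submodule.torsion (Polynomial ℂ) B, (Polynomial.X : Polynomial ℂ) ^ m • x = 0)
    (y : CokerUdiff A B) (hy : ∃ k : ℕ, (Polynomial.X : Polynomial ℂ) ^ k • y = 0) :
    (Polynomial.X : Polynomial ℂ) ^ m • y = 0 := by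
  obtain ⟨k, hk⟩ := hy
  obtain ⟨t, rfl⟩ := Submodule.Quotient.mk_surjective _ y
  rw [← Submodule.Quotient.mk_smul, Submodule.Quotient.mk_eq_zero] at hk ⊢
  apply ker_mapOfCompatibleSMul_le_range_Udiff A B
  have hk' := range_Udiff_le_ker_mapOfCompatibleSMul A B hk
  rw [LinearMap.mem_ker, map_smul] at hk' ⊢
  exact smul_eq_zero_of_mem_torsion_tensorProduct hmA hmB (pow_ne_zero k X_ne_zero) hk'

end
end

section
/- Let A and B be finitely generated ℂ[U]-modules. Then the kernel of U₁ − U₂ : A ⊗_ℂ B → A ⊗_ℂ B is contained in the image of the canonical map T(A) ⊗_ℂ T(B) → A ⊗_ℂ B induced by the inclusions of the torsion submodules. -/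
open Polynomial TensorProduct

noncomputable section

/-- An element of a `ℂ[U]`-module lying in a finite-dimensional subspace stable under `U`
is torsion. -/
lemma mem_torsion_of_mem_finiteDimensional_of_stable {M : Type} [AddCommGroup M] [Module ℂ M]
    [Module (Polynomial ℂ) M] [IsScalarTower ℂ (Polynomial ℂ) M] (V : Submodule ℂ M)
    [FiniteDimensional ℂ V] (hV : ∀ v ∈ V, (Polynomial.X : Polynomial ℂ) • v ∈ V)
    {m : M} (hm : m ∈ V) : m ∈ Submodule.torsion (Polynomial ℂ) M := by
  have hpow (n : ℕ) : (Polynomial.X : Polynomial ℂ) ^ n • m ∈ V := by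
    induction n with
    | zero => simpa using hm
    | succ n ih => rw [pow_succ', mul_smul]; exact hV _ ih
  have hp (p : Polynomial ℂ) : p • m ∈ V := by
    induction p using Polynomial.induction_on' with
    | add p q hp hq => rw [add_smul]; exact V.add_mem hp hq
    | monomial n c =>
      rw [← Polynomial.smul_X_eq_monomial, smul_assoc]
      exact V.smul_mem c (hpow n)
  let g : Polynomial ℂ →ₗ[ℂ] V :=
    (((LinearMap.toSpanSingleton (Polynomial ℂ) M m).restrictScalars ℂ).codRestrict V hp)
  have hg : ¬ Function.Injective g := fun h =>
    Polynomial.not_finite (R := ℂ) (Module.Finite.of_injective g h)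
  rw [injective_iff_map_eq_zero] at hg
  push Not at hg
  obtain ⟨p, hp0, hpne⟩ := hg
  exact (Submodule.mem_torsion_iff m).2
    ⟨⟨p, mem_nonZeroDivisors_of_ne_zero hpne⟩, congrArg Subtype.val hp0⟩

/-- Contraction of a tensor with linear functionals on the right factor. -/
def rightContraction {A B : Type} [AddCommGroup A] [Module ℂ A] [AddCommGroup B] [Module ℂ B] :
    A ⊗[ℂ] B →ₗ[ℂ] Module.Dual ℂ B →ₗ[ℂ] A :=
  TensorProduct.lift
    (LinearMap.mk₂ ℂ (fun a b => (Module.Dual.eval ℂ B b).smulRight a)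
      (fun _ _ _ => by ext; simp) (fun c a b => by ext φ; exact smul_comm (φ b) c a)
      (fun _ _ _ => by ext; simp [add_smul]) (fun _ _ _ => by ext; simp [mul_smul]))

section rightContraction

variable {A A' B B' : Type} [AddCommGroup A] [Module ℂ A] [AddCommGroup A'] [Module ℂ A']
  [AddCommGroup B] [Module ℂ B] [AddCommGroup B'] [Module ℂ B']

@[simp]
lemma rightContraction_tmul (a : A) (b : B) (φ : Module.Dual ℂ B) :
    rightContraction (a ⊗ₜ[ℂ] b) φ = φ b • a := by
  simp [rightContraction]

lemma rightContraction_map (f : A →ₗ[ℂ] A') (g : B →ₗ[ℂ] B') (x : A ⊗[ℂ] B)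
    (φ : Module.Dual ℂ B') :
    rightContraction (TensorProduct.map f g x) φ = f (rightContraction x (φ ∘ₗ g)) := by
  induction x with
  | zero => simp
  | add x y hx hy => simp [hx, hy]
  | tmul a b => simp

lemma rightContraction_injective :
    Function.Injective (rightContraction : A ⊗[ℂ] B →ₗ[ℂ] Module.Dual ℂ B →ₗ[ℂ] A) := by
  classical
  rw [injective_iff_map_eq_zero]
  intro x hx
  let b := Module.Free.chooseBasis ℂ B
  apply (TensorProduct.equivFinsuppOfBasisRight (M := A) b).injective
  ext i
  have key (y : A ⊗[ℂ] B) :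
      TensorProduct.equivFinsuppOfBasisRight b y i = rightContraction y (b.coord i) := by
    induction y with
    | zero => simp
    | add y z hy hz => simp [hy, hz]
    | tmul a c => simp
  rw [key, hx]
  simp

instance finiteDimensional_range_rightContraction (x : A ⊗[ℂ] B) :
    FiniteDimensional ℂ (LinearMap.range (rightContraction x)) := by
  induction x with
  | zero => rw [map_zero, LinearMap.range_zero]; infer_instance
  | add x y hx hy =>
    rw [map_add]
    refine Submodule.finiteDimensional_of_le
      (S₂ := LinearMap.range (rightContraction x) ⊔ LinearMap.range (rightContraction y)) ?_
    rintro _ ⟨φ, rfl⟩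
    exact Submodule.add_mem_sup ⟨φ, rfl⟩ ⟨φ, rfl⟩
  | tmul a b =>
    refine Submodule.finiteDimensional_of_le (S₂ := Submodule.span ℂ {a}) ?_
    rintro _ ⟨φ, rfl⟩
    rw [rightContraction_tmul]
    exact Submodule.smul_mem _ _ (Submodule.mem_span_singleton_self a)

end rightContraction

/-- If `U₁` and `U₂` agree on a tensor, then any linear map that is the identity on the torsion
of the left factor fixes this tensor. -/
lemma map_id_eq_self_of_Uact_eq {A B : Type}
    [AddCommGroup A] [Module ℂ A] [Module (Polynomial ℂ) A] [IsScalarTower ℂ (Polynomial ℂ) A]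
    [AddCommGroup B] [Module ℂ B] [Module (Polynomial ℂ) B] [IsScalarTower ℂ (Polynomial ℂ) B]
    {x : A ⊗[ℂ] B}
    (hx : TensorProduct.map ((Uact A).restrictScalars ℂ) LinearMap.id x =
      TensorProduct.map LinearMap.id ((Uact B).restrictScalars ℂ) x)
    (p : A →ₗ[ℂ] A) (hp : ∀ a ∈ Submodule.torsion (Polynomial ℂ) A, p a = a) :
    TensorProduct.map p LinearMap.id x = x := by
  apply rightContraction_injective
  ext φ
  rw [rightContraction_map, LinearMap.comp_id]
  refine hp _ (mem_torsion_of_mem_finiteDimensional_of_stable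
    (LinearMap.range (rightContraction x)) ?_ ⟨φ, rfl⟩)
  rintro _ ⟨ψ, rfl⟩
  have h := congrArg (fun z => rightContraction z ψ) hx
  simp only [rightContraction_map, LinearMap.comp_id, LinearMap.id_apply] at h
  exact ⟨_, h.symm⟩

/-- There is a `ℂ`-linear projection of a `ℂ[U]`-module onto its torsion submodule. -/
lemma exists_projection_torsion (M : Type) [AddCommGroup M] [Module ℂ M]
    [Module (Polynomial ℂ) M] [IsScalarTower ℂ (Polynomial ℂ) M] :
    ∃ p : M →ₗ[ℂ] Submodule.torsion (Polynomial ℂ) M,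
      ∀ m ∈ Submodule.torsion (Polynomial ℂ) M, (p m : M) = m := by
  obtain ⟨p, hp⟩ := LinearMap.exists_leftInverse_of_injective
    ((Submodule.torsion (Polynomial ℂ) M).subtype.restrictScalars ℂ)
    (LinearMap.ker_eq_bot.2 Subtype.val_injective)
  exact ⟨p, fun m hm => congrArg Subtype.val (LinearMap.congr_fun hp ⟨m, hm⟩)⟩

variable (A B : Type)
  [AddCommGroup A] [Module ℂ A] [Module (Polynomial ℂ) A] [IsScalarTower ℂ (Polynomial ℂ) A]
  [AddCommGroup B] [Module ℂ B] [Module (Polynomial ℂ) B] [IsScalarTower ℂ (Polynomial ℂ) B]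

/-- For finitely generated `A` and `B`, the kernel of `U₁ - U₂` on `A ⊗[ℂ] B` is contained
in the image of `T(A) ⊗[ℂ] T(B)` under the map induced by the inclusions of the torsion
submodules. -/
theorem ker_Udiff_le_range_torsion_tmul
    [Module.Finite (Polynomial ℂ) A] [Module.Finite (Polynomial ℂ) B]
    (x : A ⊗[ℂ] B) (hx : Udiff A B x = 0) :
    x ∈ LinearMap.range (TensorProduct.map
      (((Submodule.torsion (Polynomial ℂ) A).subtype).restrictScalars ℂ)
      (((Submodule.torsion (Polynomial ℂ) B).subtype).restrictScalars ℂ)) := by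
  obtain ⟨p, hp⟩ := exists_projection_torsion A
  obtain ⟨q, hq⟩ := exists_projection_torsion B
  set ιA := (Submodule.torsion (Polynomial ℂ) A).subtype.restrictScalars ℂ
  set ιB := (Submodule.torsion (Polynomial ℂ) B).subtype.restrictScalars ℂ
  have hU : TensorProduct.map ((Uact A).restrictScalars ℂ) LinearMap.id x =
      TensorProduct.map LinearMap.id ((Uact B).restrictScalars ℂ) x := sub_eq_zero.1 hx
  have hleft : TensorProduct.map (ιA ∘ₗ p) LinearMap.id x = x :=
    map_id_eq_self_of_Uact_eq hU _ hp
  have hright : TensorProduct.map LinearMap.id (ιB ∘ₗ q) x = x := by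
    apply (TensorProduct.comm ℂ A B).injective
    rw [← TensorProduct.map_comm]
    refine map_id_eq_self_of_Uact_eq ?_ _ hq
    rw [TensorProduct.map_comm, TensorProduct.map_comm, hU]
  refine ⟨TensorProduct.map p q x, ?_⟩
  rw [← LinearMap.comp_apply, ← TensorProduct.map_comp]
  conv_rhs => rw [← hleft, ← hright]
  rw [← LinearMap.comp_apply, ← TensorProduct.map_comp, LinearMap.comp_id, LinearMap.id_comp]

end
end
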